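/- arXiv:2101.12664 — 8 statements merged into one kernel-verified Lean document; each statement's English description precedes it below -/
import Mathlib

section
/- Let f = ∑_{j=0}^g c_j s^j ∈ ℤ[s] be monic of degree g ≥ 1 with complex roots r_1, …, r_g, let m be an integer, and let W_{f,m}(t) := ∑_{j=0}^g c_j (t+m)^{2j} t^{g−j} ∈ ℤ[t]. Then W_{f,m} is monic of degree 2g and its image in ℂ[t] factors as W_{f,m}(t) = ∏_{i=1}^g ( t² + (2m − r_i) t + m² ). -/
open Polynomial

/-- For a polynomial `f = ∑ c_j s^j ∈ ℤ[s]` of degree `g` and an integer `m`,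
`weilPoly f m = ∑_{j=0}^{g} c_j (t+m)^{2j} t^{g-j} ∈ ℤ[t]`. -/
noncomputable def weilPoly (f : Polynomial ℤ) (m : ℤ) : Polynomial ℤ :=
  ∑ j ∈ Finset.range (f.natDegree + 1),
    Polynomial.C (f.coeff j) * (Polynomial.X + Polynomial.C m) ^ (2 * j) *
      Polynomial.X ^ (f.natDegree - j)

theorem hom_prod_aux (A B : Polynomial ℂ) (s : Multiset ℂ) :
    ∑ j ∈ Finset.range (Multiset.card s + 1),
      C (((s.map (fun r => X - C r)).prod).coeff j) * A ^ j * B ^ (Multiset.card s - j) =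
      (s.map (fun r => A - C r * B)).prod := by
  induction s using Multiset.induction_on with
  | empty => simp
  | cons r s ih =>
    rw [Multiset.map_cons, Multiset.prod_cons, Multiset.map_cons, Multiset.prod_cons, ← ih,
      Multiset.card_cons]
    have hdeg : ((s.map (fun r => (X : Polynomial ℂ) - C r)).prod).natDegree
        = Multiset.card s := natDegree_multiset_prod_X_sub_C_eq_card s
    set P := (s.map (fun r => (X : Polynomial ℂ) - C r)).prod with hP
    set n := Multiset.card s with hn
    have h0 : P.coeff (n + 1) = 0 := coeff_eq_zero_of_natDegree_lt (by omega)
    have e1 : ∑ j ∈ Finset.range (n + 1 + 1), C ((X * P).coeff j) * A ^ j * B ^ (n + 1 - j)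
        = A * ∑ j ∈ Finset.range (n + 1), C (P.coeff j) * A ^ j * B ^ (n - j) := by
      rw [Finset.sum_range_succ', Finset.mul_sum]
      simp only [coeff_X_mul, mul_coeff_zero, coeff_X_zero, zero_mul, map_zero, add_zero]
      refine Finset.sum_congr rfl fun j _ => ?_
      rw [Nat.add_sub_add_right]
      ring
    have e2 : ∑ j ∈ Finset.range (n + 1 + 1), C ((C r * P).coeff j) * A ^ j * B ^ (n + 1 - j)
        = C r * B * ∑ j ∈ Finset.range (n + 1), C (P.coeff j) * A ^ j * B ^ (n - j) := by
      rw [Finset.sum_range_succ, Finset.mul_sum]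
      simp only [coeff_C_mul, h0, zero_mul, mul_zero, map_zero, add_zero]
      refine Finset.sum_congr rfl fun j hj => ?_
      have : n + 1 - j = (n - j) + 1 := by
        have := Finset.mem_range.mp hj
        omega
      rw [this, C_mul]
      ring
    rw [sub_mul (A) , ← e1, ← e2, ← Finset.sum_sub_distrib]
    refine Finset.sum_congr rfl fun j _ => ?_
    rw [sub_mul X, coeff_sub, C_sub]
    ring

/-- If f ∈ ℤ[s] is monic of degree g ≥ 1 with complex roots r_1,…,r_g
and m is an integer, then W_{f,m} is monic of degree 2g and its image in ℂ[t]
factors as ∏_{i=1}^g (t² + (2m − r_i)t + m²). -/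
theorem stmt_2 (f : Polynomial ℤ) (hf : f.Monic) (hg : 1 ≤ f.natDegree) (m : ℤ) :
    (weilPoly f m).Monic ∧ (weilPoly f m).natDegree = 2 * f.natDegree ∧
      (weilPoly f m).map (Int.castRingHom ℂ) =
        (((f.map (Int.castRingHom ℂ)).roots).map
          (fun r => Polynomial.X ^ 2 + Polynomial.C ((2 * m : ℂ) - r) * Polynomial.X +
            Polynomial.C ((m : ℂ) ^ 2))).prod := by
  have hinj : Function.Injective (Int.castRingHom ℂ) := Int.cast_injective
  have hs : (f.map (Int.castRingHom ℂ)).Splits := IsAlgClosed.splits _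
  have hfm : (f.map (Int.castRingHom ℂ)).Monic := hf.map _
  have hcard : Multiset.card (f.map (Int.castRingHom ℂ)).roots = f.natDegree := by
    rw [← hs.natDegree_eq_card_roots, natDegree_map_eq_of_injective hinj]
  have hprod : ((f.map (Int.castRingHom ℂ)).roots.map (fun r => X - C r)).prod
      = f.map (Int.castRingHom ℂ) := (hs.eq_prod_roots_of_monic hfm).symm
  have key : (weilPoly f m).map (Int.castRingHom ℂ) =
        (((f.map (Int.castRingHom ℂ)).roots).map
          (fun r => Polynomial.X ^ 2 + Polynomial.C ((2 * m : ℂ) - r) * Polynomial.X +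
            Polynomial.C ((m : ℂ) ^ 2))).prod := by
    have h := hom_prod_aux ((X + C (m : ℂ)) ^ 2) X (f.map (Int.castRingHom ℂ)).roots
    rw [hprod, hcard] at h
    have e : (fun r : ℂ => (X : Polynomial ℂ) ^ 2 + C ((2 * m : ℂ) - r) * X + C ((m : ℂ) ^ 2))
        = fun r => (X + C (m : ℂ)) ^ 2 - C r * X := by
      funext r
      simp only [C_sub, C_mul, C_pow, map_ofNat]
      ring
    rw [e, ← h, weilPoly, Polynomial.map_sum]
    refine Finset.sum_congr rfl fun j _ => ?_
    simp [pow_mul]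
  have hq : ∀ r : ℂ, ((X : Polynomial ℂ) ^ 2 + C ((2 * m : ℂ) - r) * X + C ((m : ℂ) ^ 2)).Monic ∧
      ((X : Polynomial ℂ) ^ 2 + C ((2 * m : ℂ) - r) * X + C ((m : ℂ) ^ 2)).natDegree = 2 := by
    intro r
    constructor
    · monicity!
    · compute_degree!
  refine ⟨?_, ?_, key⟩
  · rw [hinj.monic_map_iff, key]
    exact monic_multiset_prod_of_monic _ _ fun r _ => (hq r).1
  · rw [← natDegree_map_eq_of_injective hinj, key, natDegree_multiset_prod_of_monic]
    · rw [Multiset.map_map]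
      simp only [Function.comp_def, (hq _).2]
      simp [hcard, mul_comm]
    · intro p hp
      obtain ⟨r, _, rfl⟩ := Multiset.mem_map.mp hp
      exact (hq r).1
end

section
/- Let m ≥ 1 be an integer and let f ∈ ℤ[s] be monic of degree g ≥ 1 all of whose complex roots are real and lie in the open interval (0, 4m). Then f is irreducible over ℚ if and only if the degree-2g polynomial W_{f,m} ∈ ℤ[t] is irreducible over ℚ. -/
open Polynomial

noncomputable def wpQ (p : Polynomial ℚ) (c : ℚ) : Polynomial ℚ :=
  ∑ j ∈ Finset.range (p.natDegree + 1),
    Polynomial.C (p.coeff j) * (Polynomial.X + Polynomial.C c) ^ (2 * j) *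
      Polynomial.X ^ (p.natDegree - j)

lemma wpQ_split (p : Polynomial ℚ) (c : ℚ) (hp : p.Monic) :
    (wpQ p c).Monic ∧ (wpQ p c).natDegree = 2 * p.natDegree := by
  have hM : ((X + C c : ℚ[X]) ^ (2 * p.natDegree)).Monic := (monic_X_add_C c).pow _
  have hD : ((X + C c : ℚ[X]) ^ (2 * p.natDegree)).natDegree = 2 * p.natDegree := by
    rw [natDegree_pow, natDegree_X_add_C, mul_one]
  have hdeg : (∑ j ∈ Finset.range p.natDegree,
      C (p.coeff j) * (X + C c : ℚ[X]) ^ (2 * j) * X ^ (p.natDegree - j)).degree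
      < ((X + C c : ℚ[X]) ^ (2 * p.natDegree)).degree := by
    rw [degree_eq_natDegree hM.ne_zero, hD]
    refine lt_of_le_of_lt (degree_sum_le _ _) ?_
    rw [Finset.sup_lt_iff (WithBot.bot_lt_coe _)]
    intro j hj
    have hj' := Finset.mem_range.1 hj
    refine lt_of_le_of_lt degree_le_natDegree ?_
    have h1 : (C (p.coeff j) * (X + C c : ℚ[X]) ^ (2 * j) * X ^ (p.natDegree - j)).natDegree
        ≤ 2 * j + (p.natDegree - j) := by
      refine natDegree_mul_le.trans (add_le_add ((natDegree_C_mul_le _ _).trans ?_) ?_)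
      · rw [natDegree_pow, natDegree_X_add_C, mul_one]
      · rw [natDegree_X_pow]
    exact_mod_cast (by omega : _ < 2 * p.natDegree)
  have heq : wpQ p c = (X + C c : ℚ[X]) ^ (2 * p.natDegree) + ∑ j ∈ Finset.range p.natDegree,
      C (p.coeff j) * (X + C c : ℚ[X]) ^ (2 * j) * X ^ (p.natDegree - j) := by
    rw [wpQ, Finset.sum_range_succ, hp.coeff_natDegree]
    simp [add_comm]
  rw [heq]
  exact ⟨hM.add_of_left hdeg, by rw [natDegree_add_eq_left_of_degree_lt hdeg, hD]⟩

lemma wpQ_aeval (p : Polynomial ℚ) (c : ℚ) (t : ℂ) (ht : t ≠ 0) :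
    aeval t (wpQ p c) = t ^ p.natDegree * aeval ((t + c) ^ 2 / t) p := by
  rw [wpQ, map_sum, aeval_eq_sum_range, Finset.mul_sum]
  refine Finset.sum_congr rfl fun j hj => ?_
  have hj' : j ≤ p.natDegree := by have := Finset.mem_range.1 hj; omega
  obtain ⟨k, hk⟩ := Nat.exists_eq_add_of_le hj'
  rw [hk]
  simp only [map_mul, map_pow, map_add, aeval_X, aeval_C, Algebra.smul_def, Nat.add_sub_cancel_left,
    eq_ratCast, div_pow, pow_mul, pow_add]
  field_simp

lemma wpQ_aeval_zero (p : Polynomial ℚ) (c : ℚ) (hp : p.Monic) :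
    aeval (0 : ℂ) (wpQ p c) = c ^ (2 * p.natDegree) := by
  rw [wpQ, map_sum, Finset.sum_range_succ, Finset.sum_eq_zero]
  · simp [hp.coeff_natDegree]
  · intro j hj
    have := Finset.mem_range.1 hj
    have h : p.natDegree - j ≠ 0 := by omega
    simp [h]

lemma weil_map (f : ℤ[X]) (m : ℤ) :
    (weilPoly f m).map (Int.castRingHom ℚ) = wpQ (f.map (Int.castRingHom ℚ)) m := by
  rw [weilPoly, wpQ, natDegree_map_eq_of_injective (Int.castRingHom ℚ).injective_int,
    Polynomial.map_sum]
  refine Finset.sum_congr rfl fun j _ => ?_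
  simp

lemma monic_irred_of_le {p : ℚ[X]} (hp : p.Monic) {z : ℂ} (hz : aeval z p = 0)
    (hd : p.natDegree ≤ (minpoly ℚ z).natDegree) : Irreducible p := by
  have hint : IsIntegral ℚ z := ⟨p, hp, by simpa [aeval_def] using hz⟩
  have := eq_of_monic_of_dvd_of_natDegree_le (minpoly.monic hint) hp (minpoly.dvd ℚ z hz) hd
  rw [this]
  exact minpoly.irreducible hint

/-- Let m ≥ 1 be an integer and f ∈ ℤ[s] monic of degree g ≥ 1, all of
whose complex roots are real and lie in (0, 4m). Then f is irreducible over ℚ iff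
W_{f,m} is irreducible over ℚ. -/
theorem stmt_3 (m : ℤ) (hm : 1 ≤ m) (f : Polynomial ℤ) (hf : f.Monic)
    (hg : 1 ≤ f.natDegree)
    (hroots : ∀ z : ℂ, (Polynomial.aeval z) f = 0 →
      z.im = 0 ∧ 0 < z.re ∧ z.re < 4 * m) :
    Irreducible (f.map (Int.castRingHom ℚ)) ↔
      Irreducible ((weilPoly f m).map (Int.castRingHom ℚ)) := by
  set F := f.map (Int.castRingHom ℚ) with hF
  have hFm : F.Monic := hf.map _
  have hFd : F.natDegree = f.natDegree :=
    natDegree_map_eq_of_injective (Int.castRingHom ℚ).injective_int _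
  rw [weil_map, ← hF]
  obtain ⟨hWm, hWd⟩ := wpQ_split F m hFm
  obtain ⟨t, ht⟩ : ∃ t : ℂ, aeval t (wpQ F m) = 0 := by
    refine IsAlgClosed.exists_aeval_eq_zero ℂ _ ?_
    rw [degree_eq_natDegree hWm.ne_zero, hWd]
    exact_mod_cast (by omega : 2 * F.natDegree ≠ 0)
  have ht0 : t ≠ 0 := by
    rintro rfl
    rw [wpQ_aeval_zero F m hFm] at ht
    have := (pow_eq_zero_iff (by omega : 2 * F.natDegree ≠ 0)).1 ht
    have : m = 0 := by exact_mod_cast this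
    omega
  set s : ℂ := (t + (m : ℚ)) ^ 2 / t with hs
  have hsF : aeval s F = 0 := by
    have := wpQ_aeval F m t ht0
    rw [ht] at this
    exact (mul_eq_zero.1 this.symm).resolve_left (pow_ne_zero _ ht0)
  have hsf : aeval s f = 0 := by
    rw [hF, aeval_def, eval₂_map] at hsF
    rw [aeval_def, ← hsF]
    congr 1
  obtain ⟨hsi, hs0, hs4⟩ := hroots s hsf
  have hst : s * t = (t + m) ^ 2 := by
    rw [hs]; field_simp; push_cast; ring
  have hti : t.im ≠ 0 := by
    intro h
    have h2 := congrArg Complex.re hst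
    simp [pow_two, h, hsi] at h2
    have hm' : (1 : ℝ) ≤ m := by exact_mod_cast hm
    have h3 : 0 < t.re := by
      have : 0 ≤ s.re * t.re := by rw [h2]; exact mul_self_nonneg _
      have h4 := nonneg_of_mul_nonneg_right this hs0
      refine lt_of_le_of_ne h4 fun h5 => ht0 (Complex.ext h5.symm h)
    nlinarith [sq_nonneg (t.re - m), mul_lt_mul_of_pos_right hs4 h3]
  have hint : IsIntegral ℚ t := ⟨_, hWm, by simpa [aeval_def] using ht⟩
  have hints : IsIntegral ℚ s := ⟨_, hFm, by simpa [aeval_def] using hsF⟩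
  constructor
  · intro hirr
    refine monic_irred_of_le hWm ht ?_
    have hmin : F = minpoly ℚ s := minpoly.eq_of_irreducible_of_monic hirr hsF hFm
    have hsmem : s ∈ IntermediateField.adjoin ℚ {t} := by
      have h1 := IntermediateField.mem_adjoin_simple_self ℚ t
      have h2 := (IntermediateField.adjoin ℚ {t}).algebraMap_mem (m : ℚ)
      exact div_mem (pow_mem (add_mem h1 (by simpa using h2)) 2) h1
    have hle : IntermediateField.adjoin ℚ {s} ≤ IntermediateField.adjoin ℚ {t} :=
      IntermediateField.adjoin_simple_le_iff.2 hsmem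
    have hds := IntermediateField.adjoin.finrank hints
    have hdt := IntermediateField.adjoin.finrank hint
    haveI : FiniteDimensional ℚ (IntermediateField.adjoin ℚ {t}) :=
      IntermediateField.adjoin.finiteDimensional hint
    have hdvd : Module.finrank ℚ (IntermediateField.adjoin ℚ {s}) ∣
        Module.finrank ℚ (IntermediateField.adjoin ℚ {t}) :=
      IntermediateField.finrank_dvd_of_le_right hle
    have hne : Module.finrank ℚ (IntermediateField.adjoin ℚ {s}) ≠
        Module.finrank ℚ (IntermediateField.adjoin ℚ {t}) := by
      intro h
      have heq := IntermediateField.eq_of_le_of_finrank_eq hle h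
      have htm : t ∈ IntermediateField.adjoin ℚ {s} := by
        rw [heq]; exact IntermediateField.mem_adjoin_simple_self ℚ t
      have hR : IntermediateField.adjoin ℚ {s} ≤ (IsScalarTower.toAlgHom ℚ ℝ ℂ).fieldRange := by
        rw [IntermediateField.adjoin_simple_le_iff]
        exact ⟨s.re, Complex.ext (by simp) (by simp [hsi])⟩
      obtain ⟨x, hx⟩ := hR htm
      apply hti
      rw [← hx]
      simp
    rw [hds, hdt, ← hmin] at hdvd hne
    obtain ⟨k, hk⟩ := hdvd
    rw [hWd, hk]
    have hpos := minpoly.natDegree_pos hint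
    rcases k with _ | _ | k
    · omega
    · omega
    · nlinarith
  · intro hirr
    refine monic_irred_of_le hFm hsF ?_
    have hmin : wpQ F m = minpoly ℚ t := minpoly.eq_of_irreducible_of_monic hirr ht hWm
    obtain ⟨hPm, hPd⟩ := wpQ_split (minpoly ℚ s) m (minpoly.monic hints)
    have h0 : aeval t (wpQ (minpoly ℚ s) m) = 0 := by
      rw [wpQ_aeval _ _ _ ht0, ← hs, minpoly.aeval, mul_zero]
    have := natDegree_le_of_dvd (minpoly.dvd ℚ t h0) hPm.ne_zero
    rw [← hmin] at this
    omega
end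

section
/- Let f ∈ ℤ[s] be monic of degree g ≥ 1, let m be an integer, and let ℓ be a prime number. If ℓ divides both W_{f,m}(1) and the derivative value W_{f,m}′(1), then ℓ divides the integer f(4)·f(0)·disc(f). -/
open Polynomial

/-- The discriminant of a monic polynomial `f ∈ ℤ[s]`, computed in ℂ as
`(-1)^{g(g-1)/2} ∏_i f'(r_i) = ∏_{i<j} (r_i - r_j)²`, where `r_1, …, r_g` are the
complex roots of `f` (this equals `(-1)^{g(g-1)/2} Res(f, f')` since `f` is monic). -/
noncomputable def discC (f : Polynomial ℤ) : ℂ :=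
  (-1) ^ (f.natDegree * (f.natDegree - 1) / 2) *
    (((f.map (Int.castRingHom ℂ)).roots).map
      (fun r => ((Polynomial.derivative f).map (Int.castRingHom ℂ)).eval r)).prod


lemma weil_eval_one (f : Polynomial ℤ) (m : ℤ) :
    (weilPoly f m).eval 1 = f.eval ((1 + m) ^ 2) := by
  rw [weilPoly, eval_finset_sum, eval_eq_sum_range]
  refine Finset.sum_congr rfl fun j _ => ?_
  simp [pow_mul]

lemma weil_deriv_one (f : Polynomial ℤ) (m : ℤ) :
    (derivative (weilPoly f m)).eval 1 = f.natDegree * f.eval ((1 + m) ^ 2)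
      + (1 + m) * (2 - (1 + m)) * (derivative f).eval ((1 + m) ^ 2) := by
  have hd : (derivative f).eval ((1 + m) ^ 2) =
      ∑ j ∈ Finset.range (f.natDegree + 1), f.coeff j * (j * ((1 + m) ^ 2) ^ (j - 1)) := by
    conv_lhs => rw [f.as_sum_range_C_mul_X_pow]
    rw [derivative_sum, eval_finset_sum]
    refine Finset.sum_congr rfl fun j _ => ?_
    simp [derivative_X_pow]
  rw [hd, weilPoly, derivative_sum, eval_finset_sum, eval_eq_sum_range, Finset.mul_sum,
    Finset.mul_sum, ← Finset.sum_add_distrib]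
  refine Finset.sum_congr rfl fun j hj => ?_
  have hj' : j ≤ f.natDegree := by simpa [Nat.lt_succ_iff] using hj
  obtain ⟨k, hk⟩ := Nat.exists_eq_add_of_le hj'
  rw [hk]
  rcases j with _ | j
  · simp [derivative_X_pow]; ring
  · have e : 2 * (j + 1) - 1 = 2 * j + 1 := by omega
    simp [derivative_mul, derivative_X_pow, derivative_pow, e, pow_mul]
    ring

theorem stmt_7 (f : Polynomial ℤ) (hf : f.Monic) (hg : 1 ≤ f.natDegree) (m : ℤ)
    (ℓ : ℕ) (hℓ : ℓ.Prime)
    (h1 : (ℓ : ℤ) ∣ (weilPoly f m).eval 1)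
    (h2 : (ℓ : ℤ) ∣ (Polynomial.derivative (weilPoly f m)).eval 1)
    (D : ℤ) (hD : (D : ℂ) = discC f) :
    (ℓ : ℤ) ∣ f.eval 4 * f.eval 0 * D := by
  have hp : Prime (ℓ : ℤ) := Nat.prime_iff_prime_int.mp hℓ
  rw [weil_eval_one] at h1
  rw [weil_deriv_one, dvd_add_right (h1.mul_left _)] at h2
  have key : ∀ a : ℤ, (ℓ : ℤ) ∣ (1 + m) ^ 2 - a → (ℓ : ℤ) ∣ f.eval a := fun a ha =>
    (dvd_sub_right h1).mp (ha.trans (sub_dvd_eval_sub _ _ f))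
  rcases hp.dvd_or_dvd h2 with h | h
  · rcases hp.dvd_or_dvd h with h | h
    · have := key 0 (by rw [sub_zero, sq]; exact h.mul_left _)
      exact (this.mul_left _).mul_right _
    · have := key 4 (by
        have : (1 + m) ^ 2 - 4 = (2 - (1 + m)) * (-(1 + m) - 2) := by ring
        rw [this]; exact h.mul_right _)
      exact (this.mul_right _).mul_right _
  · refine Dvd.dvd.mul_left ?_ _
    have hres : ((f.resultant (derivative f) : ℤ) : ℂ) =
        ((f.map (Int.castRingHom ℂ)).roots.map
          (fun r => ((derivative f).map (Int.castRingHom ℂ)).eval r)).prod := by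
      have hm := resultant_map_map f (derivative f) f.natDegree (derivative f).natDegree
        (Int.castRingHom ℂ)
      have := resultant_eq_prod_eval (f.map (Int.castRingHom ℂ))
        ((derivative f).map (Int.castRingHom ℂ)) (derivative f).natDegree
        natDegree_map_le (IsAlgClosed.splits _)
      rw [hf.natDegree_map, hm, (hf.map _).leadingCoeff, one_pow, one_mul] at this
      simpa using this
    have hDr : D = (-1) ^ (f.natDegree * (f.natDegree - 1) / 2) * f.resultant (derivative f) := by
      have : (D : ℂ) = (((-1) ^ (f.natDegree * (f.natDegree - 1) / 2) *
          f.resultant (derivative f) : ℤ) : ℂ) := by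
        rw [hD, discC, Int.cast_mul, hres]; simp
      exact_mod_cast this
    rw [hDr]
    refine Dvd.dvd.mul_left ?_ _
    obtain ⟨p, q, -, -, hpq⟩ := exists_mul_add_mul_eq_C_resultant f (derivative f) le_rfl le_rfl
      (by omega)
    have := congrArg (eval ((1 + m) ^ 2)) hpq
    simp only [eval_add, eval_mul, eval_C] at this
    rw [← this]
    exact dvd_add (h1.mul_right _) (h.mul_right _)
end

section
/- For every integer g ≥ 1 there exists a unique polynomial 𝔣⁻ ∈ 𝓕_g⁻ such that for every f ∈ 𝓕_g⁻ with f ≠ 𝔣⁻, the polynomial f − 𝔣⁻ has positive leading coefficient. -/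
open Polynomial

/-- `𝓕_g⁻`: the set of monic polynomials of degree `g` with integer coefficients
that are irreducible over ℚ and all of whose complex roots are real and negative. -/
def TotallyNegativeSet (g : ℕ) : Set (Polynomial ℤ) :=
  {f | f.Monic ∧ f.natDegree = g ∧ Irreducible (f.map (Int.castRingHom ℚ)) ∧
    ∀ z : ℂ, (Polynomial.aeval z) f = 0 → z.im = 0 ∧ z.re < 0}

lemma exists_lex_min (n : ℕ) : ∀ S : Set ℤ[X], S.Nonempty → (∀ f ∈ S, ∀ i, 0 ≤ f.coeff i) →
    (∀ f ∈ S, ∀ h ∈ S, ∀ i, n ≤ i → f.coeff i = h.coeff i) →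
    ∃ fr ∈ S, ∀ f ∈ S, f ≠ fr → 0 < (f - fr).leadingCoeff := by
  induction n with
  | zero =>
    intro S ⟨f, hf⟩ _ h
    refine ⟨f, hf, fun f' hf' hne => absurd ?_ hne⟩
    ext i
    exact h f' hf' f hf i (Nat.zero_le _)
  | succ n ih =>
    intro S hS hpos h
    obtain ⟨f0, hf0, hmin⟩ : ∃ f0 ∈ S, ∀ f ∈ S, f0.coeff n ≤ f.coeff n := by
      have hwf := (measure (fun f : ℤ[X] => (f.coeff n).toNat)).wf
      refine ⟨hwf.min S hS, hwf.min_mem S hS, fun f hf => ?_⟩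
      have h1 := hwf.not_lt_min S hf
      have h2 := hpos f hf n
      have h3 := hpos _ (hwf.min_mem S hS) n
      change ¬ ((f.coeff n).toNat < ((hwf.min S hS).coeff n).toNat) at h1
      omega
    obtain ⟨fr, hfr, hfr2⟩ := ih {f ∈ S | f.coeff n = f0.coeff n} ⟨f0, hf0, rfl⟩
      (fun f hf => hpos f hf.1) (by
        intro f hf k hk i hi
        rcases Nat.eq_or_lt_of_le hi with rfl | hi
        · rw [hf.2, hk.2]
        · exact h f hf.1 k hk.1 i hi)
    refine ⟨fr, hfr.1, fun f hf hne => ?_⟩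
    by_cases hc : f.coeff n = f0.coeff n
    · exact hfr2 f ⟨hf, hc⟩ hne
    · have hlt : f0.coeff n < f.coeff n := lt_of_le_of_ne (hmin f hf) (Ne.symm hc)
      have hco : (f - fr).coeff n = f.coeff n - f0.coeff n := by rw [coeff_sub, hfr.2]
      have hd : (f - fr).natDegree = n := by
        apply natDegree_eq_of_le_of_coeff_ne_zero
        · rw [natDegree_le_iff_coeff_eq_zero]
          intro i hi
          rw [coeff_sub, h f hf fr hfr.1 i hi, sub_self]
        · rw [hco]; omega
      rw [leadingCoeff, hd, hco]; omega

lemma coeff_nonneg_aux (s : Multiset ℂ) (hs : ∀ z ∈ s, z.im = 0 ∧ z.re < 0) :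
    ∀ i, ((s.map (fun a => X - C a)).prod.coeff i).im = 0 ∧
      0 ≤ ((s.map (fun a => X - C a)).prod.coeff i).re := by
  induction s using Multiset.induction_on with
  | empty => intro i; simp [coeff_one]; split_ifs <;> simp
  | cons a s ih =>
    have ih' := ih (fun z hz => hs z (Multiset.mem_cons_of_mem hz))
    obtain ⟨h1, h2⟩ := hs a (Multiset.mem_cons_self a s)
    intro i
    rw [Multiset.map_cons, Multiset.prod_cons, sub_mul]
    cases i with
    | zero =>
      have := ih' 0
      simp [h1, this.1]; nlinarith
    | succ i =>
      have h3 := ih' i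
      have h4 := ih' (i+1)
      simp [coeff_X_mul, h1, h3.1, h4.1]; nlinarith

lemma coeff_nonneg_of_mem {g : ℕ} {f : ℤ[X]} (hf : f ∈ TotallyNegativeSet g) (i : ℕ) :
    0 ≤ f.coeff i := by
  obtain ⟨hm, -, -, hr⟩ := hf
  have hsp : (f.map (Int.castRingHom ℂ)).Splits := IsAlgClosed.splits _
  have h1 := hsp.eq_prod_roots_of_monic (hm.map _)
  have h2 := coeff_nonneg_aux (f.map (Int.castRingHom ℂ)).roots (by
    intro z hz
    apply hr
    have := isRoot_of_mem_roots hz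
    rw [IsRoot, eval_map] at this
    rw [aeval_def]; exact this) i
  rw [← h1] at h2
  simpa using h2.2

noncomputable def wit (g : ℕ) : ℤ[X] := (∏ i ∈ Finset.range g, (X + C (8 * ((i:ℤ) + 1)))) + C 2

lemma wit_monic_deg (g : ℕ) (hg : 1 ≤ g) : (wit g).Monic ∧ (wit g).natDegree = g := by
  have hP : (∏ i ∈ Finset.range g, (X + C (8 * ((i:ℤ) + 1)))).Monic :=
    monic_prod_of_monic _ _ (fun i _ => monic_X_add_C _)
  have hd : (∏ i ∈ Finset.range g, (X + C (8 * ((i:ℤ) + 1)))).natDegree = g := by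
    rw [natDegree_prod_of_monic _ _ (fun i _ => monic_X_add_C _)]
    simp only [natDegree_X_add_C]; simp
  refine ⟨?_, ?_⟩
  · apply hP.add_of_left
    rw [degree_eq_natDegree hP.ne_zero, hd]
    exact lt_of_le_of_lt degree_C_le (by exact_mod_cast hg)
  · rw [wit, natDegree_add_C, hd]

lemma wit_irr (g : ℕ) (hg : 1 ≤ g) : Irreducible ((wit g).map (Int.castRingHom ℚ)) := by
  obtain ⟨hm, hd⟩ := wit_monic_deg g hg
  rw [← IsPrimitive.Int.irreducible_iff_irreducible_map_cast hm.isPrimitive]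
  have h2 : Prime (2:ℤ) := Int.prime_two
  have hE : (wit g).IsEisensteinAt (Ideal.span {(2:ℤ)}) := by
    refine ⟨?_, ?_, ?_⟩
    · rw [hm.leadingCoeff, Ideal.mem_span_singleton]; norm_num
    · intro n hn
      rw [hd] at hn
      rw [Ideal.mem_span_singleton]
      have hmap : (wit g).map (Int.castRingHom (ZMod 2)) = X ^ g := by
        have hc : ∀ i : ℕ, (Int.castRingHom (ZMod 2)) (8 * ((i:ℤ) + 1)) = 0 := by
          intro i
          rw [map_mul]
          have : (Int.castRingHom (ZMod 2)) 8 = 0 := by decide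
          rw [this, zero_mul]
        have hc2 : (Int.castRingHom (ZMod 2)) 2 = 0 := by decide
        simp only [wit, Polynomial.map_add, Polynomial.map_prod, map_X, map_C, hc, hc2, C_0,
          add_zero, Finset.prod_const, Finset.card_range]
      have := congrArg (fun p => p.coeff n) hmap
      simp only [coeff_map, coeff_X_pow, if_neg hn.ne] at this
      exact (ZMod.intCast_zmod_eq_zero_iff_dvd _ 2).1 (by simpa using this)
    · rw [Ideal.span_singleton_pow, Ideal.mem_span_singleton, coeff_zero_eq_eval_zero]
      have : (4:ℤ) ∣ ∏ i ∈ Finset.range g, (8 * ((i:ℤ) + 1)) :=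
        Dvd.dvd.trans ⟨2 * (((0:ℕ):ℤ) + 1), by norm_num⟩
          (Finset.dvd_prod_of_mem (fun i : ℕ => 8 * ((i:ℤ) + 1)) (Finset.mem_range.2 hg))
      have he : (wit g).eval 0 = (∏ i ∈ Finset.range g, (8 * ((i:ℤ) + 1))) + 2 := by
        simp [wit, eval_prod]
      rw [he]; omega
  exact hE.irreducible ((Ideal.span_singleton_prime (by norm_num)).2 h2) hm.isPrimitive (by omega)

lemma sign_last (g : ℕ) : ∀ m : ℕ, m ≤ g →
    (4:ℤ)^m ≤ (-1)^m * ∏ i ∈ Finset.range m, (8 * (i:ℤ) + 4 - 8 * g) := by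
  intro m
  induction m with
  | zero => simp
  | succ m ih =>
    intro h
    have := ih (by omega)
    have hp : (0:ℤ) < 4^m := by positivity
    have hc : (m:ℤ) + 1 ≤ g := by exact_mod_cast h
    rw [Finset.prod_range_succ, pow_succ, pow_succ]
    nlinarith

lemma sign_all (k : ℕ) : ∀ g : ℕ, k ≤ g →
    (4:ℤ)^g ≤ (-1)^k * ∏ i ∈ Finset.range g, (8 * (i:ℤ) + 4 - 8 * k) := by
  intro g h
  induction g, h using Nat.le_induction with
  | base => exact sign_last k k le_rfl
  | succ g h ih =>
    have hp : (0:ℤ) < 4^g := by positivity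
    have hc : (k:ℤ) ≤ g := by exact_mod_cast h
    rw [Finset.prod_range_succ, pow_succ]
    nlinarith

lemma wit_sign (g k : ℕ) (hg : 1 ≤ g) (hk : k ≤ g) :
    0 < (-1)^k * (wit g).eval (-8 * (k:ℤ) - 4) := by
  have h := sign_all k g hk
  have he : (wit g).eval (-8 * (k:ℤ) - 4) =
      (∏ i ∈ Finset.range g, (8 * (i:ℤ) + 4 - 8 * k)) + 2 := by
    simp only [wit, eval_add, eval_prod, eval_X, eval_C]
    congr 1
    apply Finset.prod_congr rfl
    intros; ring
  have h4 : (4:ℤ)^1 ≤ 4^g := pow_le_pow_right₀ (by norm_num) hg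
  rw [he]
  rcases neg_one_pow_eq_or ℤ k with h1 | h1 <;> rw [h1] at h ⊢ <;> linarith

lemma wit_root (g k : ℕ) (hk : k < g) : ∃ r : ℝ, -8 * (k:ℝ) - 12 < r ∧ r < -8 * (k:ℝ) - 4 ∧
    aeval r (wit g) = 0 := by
  have h1 := wit_sign g k (by omega) hk.le
  have h2 := wit_sign g (k+1) (by omega) hk
  have e1 : aeval (-8 * (k:ℝ) - 4) (wit g) = (((wit g).eval (-8 * (k:ℤ) - 4) : ℤ) : ℝ) := by
    have := aeval_algebraMap_apply ℝ (-8 * (k:ℤ) - 4) (wit g)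
    simpa using this
  have e2 : aeval (-8 * (k:ℝ) - 12) (wit g) = (((wit g).eval (-8 * ((k+1:ℕ):ℤ) - 4) : ℤ) : ℝ) := by
    have := aeval_algebraMap_apply ℝ (-8 * ((k+1:ℕ):ℤ) - 4) (wit g)
    have e : (-8 * (k:ℝ) - 12) = algebraMap ℤ ℝ (-8 * ((k+1:ℕ):ℤ) - 4) := by
      simp; ring
    rw [e, this]; simp
  have hcont : ContinuousOn (fun x : ℝ => aeval x (wit g)) (Set.Icc (-8 * (k:ℝ) - 12) (-8 * (k:ℝ) - 4)) :=
    (Polynomial.continuous_aeval _).continuousOn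
  have hle : (-8 * (k:ℝ) - 12) ≤ (-8 * (k:ℝ) - 4) := by linarith
  rw [pow_succ] at h2
  rcases neg_one_pow_eq_or ℤ k with hs | hs <;> rw [hs] at h1 h2
  · have h1' : (0:ℝ) < aeval (-8 * (k:ℝ) - 4) (wit g) := by
      rw [e1]; first | exact Int.cast_pos.2 (by linarith) | exact Int.cast_lt_zero.2 (by linarith)
    have h2' : aeval (-8 * (k:ℝ) - 12) (wit g) < (0:ℝ) := by
      rw [e2]; first | exact Int.cast_pos.2 (by linarith) | exact Int.cast_lt_zero.2 (by linarith)
    obtain ⟨r, hr, h0⟩ := intermediate_value_Ioo hle hcont ⟨h2', h1'⟩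
    exact ⟨r, hr.1, hr.2, h0⟩
  · have h1' : aeval (-8 * (k:ℝ) - 4) (wit g) < (0:ℝ) := by
      rw [e1]; first | exact Int.cast_pos.2 (by linarith) | exact Int.cast_lt_zero.2 (by linarith)
    have h2' : (0:ℝ) < aeval (-8 * (k:ℝ) - 12) (wit g) := by
      rw [e2]; first | exact Int.cast_pos.2 (by linarith) | exact Int.cast_lt_zero.2 (by linarith)
    obtain ⟨r, hr, h0⟩ := intermediate_value_Ioo' hle hcont ⟨h1', h2'⟩
    exact ⟨r, hr.1, hr.2, h0⟩

lemma wit_mem (g : ℕ) (hg : 1 ≤ g) : wit g ∈ TotallyNegativeSet g := by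
  obtain ⟨hm, hd⟩ := wit_monic_deg g hg
  refine ⟨hm, hd, wit_irr g hg, fun z hz => ?_⟩
  have hroot : ∀ k : Fin g, ∃ r : ℝ, -8 * ((k:ℕ):ℝ) - 12 < r ∧ r < -8 * ((k:ℕ):ℝ) - 4 ∧
    aeval r (wit g) = 0 := fun k => wit_root g k k.2
  choose r hr1 hr2 hr3 using hroot
  by_cases hzr : ∃ k, (r k : ℂ) = z
  · obtain ⟨k, rfl⟩ := hzr
    refine ⟨Complex.ofReal_im _, ?_⟩
    rw [Complex.ofReal_re]
    have := hr2 k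
    have h0 : (0:ℝ) ≤ ((k:ℕ):ℝ) := Nat.cast_nonneg _
    linarith
  · exfalso
    push Not at hzr
    have hanti : ∀ i j : Fin g, i < j → r j < r i := by
      intro i j hij
      have h1 := hr1 i
      have h2 := hr2 j
      have : ((i:ℕ):ℝ) + 1 ≤ ((j:ℕ):ℝ) := by exact_mod_cast hij
      linarith
    have hinj : Function.Injective r := by
      intro i j hij
      rcases lt_trichotomy i j with h | h | h
      · exact absurd hij (hanti i j h).ne'
      · exact h
      · exact absurd hij (hanti j i h).ne
    let φ : Option (Fin g) → ℂ := fun o => o.elim z (fun k => (r k : ℂ))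
    have hφ : Function.Injective φ := by
      intro a b hab
      cases a <;> cases b
      · rfl
      · exact absurd hab.symm (hzr _)
      · exact absurd hab (hzr _)
      · exact congrArg some (hinj (Complex.ofReal_injective hab))
    have := eq_zero_of_natDegree_lt_card_of_eval_eq_zero ((wit g).map (Int.castRingHom ℂ)) hφ (by
      intro o
      rw [eval_map]
      change aeval (φ o) (wit g) = 0
      cases o with
      | none => exact hz
      | some k =>
        have h := aeval_algebraMap_apply ℂ (r k) (wit g)
        rw [hr3 k, map_zero] at h
        exact h) (by
      rw [hm.natDegree_map, hd]; simp)
    exact (hm.map _).ne_zero this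

/-- For every g ≥ 1 there exists a unique 𝔣⁻ ∈ 𝓕_g⁻ such that for
every f ∈ 𝓕_g⁻ with f ≠ 𝔣⁻, the polynomial f − 𝔣⁻ has positive leading coefficient. -/
theorem stmt_9 (g : ℕ) (hg : 1 ≤ g) :
    ∃! fr : Polynomial ℤ, fr ∈ TotallyNegativeSet g ∧
      ∀ f ∈ TotallyNegativeSet g, f ≠ fr → 0 < (f - fr).leadingCoeff := by
  obtain ⟨fr, h1, h2⟩ := exists_lex_min g (TotallyNegativeSet g) ⟨_, wit_mem g hg⟩
    (fun f hf => coeff_nonneg_of_mem hf) (by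
      intro f hf h hh i hi
      rcases Nat.eq_or_lt_of_le hi with rfl | hi
      · have a := hf.1.coeff_natDegree
        have b := hh.1.coeff_natDegree
        rw [hf.2.1] at a
        rw [hh.2.1] at b
        rw [a, b]
      · rw [coeff_eq_zero_of_natDegree_lt (hf.2.1 ▸ hi), coeff_eq_zero_of_natDegree_lt (hh.2.1 ▸ hi)])
  refine ⟨fr, ⟨h1, h2⟩, ?_⟩
  rintro f ⟨hf1, hf2⟩
  by_contra hne
  have a := h2 f hf1 hne
  have b := hf2 fr h1 (Ne.symm hne)
  rw [← neg_sub, leadingCoeff_neg] at b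
  omega
end

section
/- For every integer m ≥ 1, the polynomial f_m(t) = t⁶ + a t⁵ + b t⁴ + c t³ + q b t² + q² a t + q³, where a = 6m − 5, b = 15m² − 20m + 6, c = 20m³ − 30m² + 12m − 1 and q = m², is irreducible over ℚ. -/
open Polynomial

/-- The Weil polynomial f_m(t) = t⁶ + a t⁵ + b t⁴ + c t³ + q b t² + q² a t + q³,
with a = 6m − 5, b = 15m² − 20m + 6, c = 20m³ − 30m² + 12m − 1 and q = m². -/
noncomputable def weilThree (m : ℤ) : Polynomial ℤ :=
  Polynomial.X ^ 6 + Polynomial.C (6 * m - 5) * Polynomial.X ^ 5 +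
    Polynomial.C (15 * m ^ 2 - 20 * m + 6) * Polynomial.X ^ 4 +
    Polynomial.C (20 * m ^ 3 - 30 * m ^ 2 + 12 * m - 1) * Polynomial.X ^ 3 +
    Polynomial.C (m ^ 2 * (15 * m ^ 2 - 20 * m + 6)) * Polynomial.X ^ 2 +
    Polynomial.C ((m ^ 2) ^ 2 * (6 * m - 5)) * Polynomial.X +
    Polynomial.C ((m ^ 2) ^ 3)

/-- The cubic satisfied by `(t+m)^2/t`. -/
noncomputable def cubicQ : Polynomial ℚ := X ^ 3 - C 5 * X ^ 2 + C 6 * X - C 1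

lemma cubicQ_natDegree : cubicQ.natDegree = 3 := by
  unfold cubicQ; compute_degree!

lemma cubicQ_monic : cubicQ.Monic := by
  unfold cubicQ; monicity!

lemma cubicQ_irreducible : Irreducible cubicQ := by
  rw [Polynomial.irreducible_iff_roots_eq_zero_of_degree_le_three
    (by rw [cubicQ_natDegree]; norm_num) (by rw [cubicQ_natDegree])]
  rw [Multiset.eq_zero_iff_forall_notMem]
  intro r hr
  have hroot := (mem_roots'.1 hr).2
  have he : r ^ 3 - 5 * r ^ 2 + 6 * r - 1 = 0 := by
    simpa [cubicQ, IsRoot] using hroot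
  have hint : IsIntegral ℤ r := by
    refine ⟨X ^ 3 - C 5 * X ^ 2 + C 6 * X - C 1, by monicity!, ?_⟩
    simpa using he
  obtain ⟨n, hn⟩ := IsIntegrallyClosed.isIntegral_iff.1 hint
  have hn' : r = (n : ℚ) := by simpa using hn.symm
  rw [hn'] at he
  have hz : n ^ 3 - 5 * n ^ 2 + 6 * n - 1 = 0 := by exact_mod_cast he
  have hd : n ∣ 1 := ⟨n ^ 2 - 5 * n + 6, by linarith⟩
  rcases Int.isUnit_iff.1 (isUnit_of_dvd_one hd) with h | h <;> subst h <;> norm_num at hz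

lemma exists_cubic_root : ∃ y : ℝ, 0 < y ∧ y < 1 ∧ y ^ 3 - 5 * y ^ 2 + 6 * y - 1 = 0 := by
  have hc : ContinuousOn (fun y : ℝ => y ^ 3 - 5 * y ^ 2 + 6 * y - 1) (Set.Icc 0 1) := by
    fun_prop
  obtain ⟨y, hy, h⟩ := intermediate_value_Ioo (by norm_num : (0 : ℝ) ≤ 1) hc
    (show (0 : ℝ) ∈ _ by norm_num)
  exact ⟨y, hy.1, hy.2, h⟩

lemma weil_natDegree (m : ℤ) : ((weilThree m).map (Int.castRingHom ℚ)).natDegree = 6 := by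
  have h : (weilThree m).Monic := by unfold weilThree; monicity!
  rw [h.natDegree_map]
  unfold weilThree; compute_degree!

lemma weil_monic (m : ℤ) : ((weilThree m).map (Int.castRingHom ℚ)).Monic := by
  have h : (weilThree m).Monic := by unfold weilThree; monicity!
  exact h.map _

/-- For every integer m ≥ 1, the polynomial f_m is irreducible over ℚ. -/
theorem stmt_12 (m : ℤ) (hm : 1 ≤ m) :
    Irreducible ((weilThree m).map (Int.castRingHom ℚ)) := by
  obtain ⟨y, hy0, hy1, hy⟩ := exists_cubic_root
  have hmR : (1 : ℝ) ≤ m := by exact_mod_cast hm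
  have hD : 0 < 4 * (m : ℝ) * y - y ^ 2 := by nlinarith
  obtain ⟨s, hs0, hs⟩ : ∃ s : ℝ, 0 < s ∧ s ^ 2 = 4 * (m : ℝ) * y - y ^ 2 :=
    ⟨_, Real.sqrt_pos.2 hD, Real.sq_sqrt hD.le⟩
  have hyC : (y : ℂ) ^ 3 - 5 * (y : ℂ) ^ 2 + 6 * y - 1 = 0 := by exact_mod_cast hy
  have hsC : (s : ℂ) ^ 2 = 4 * (m : ℂ) * y - (y : ℂ) ^ 2 := by exact_mod_cast hs
  obtain ⟨t, htdef⟩ : ∃ t : ℂ, t = ((y - 2 * m : ℂ) + Complex.I * s) / 2 := ⟨_, rfl⟩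
  have him : t.im = s / 2 := by
    rw [htdef]; simp
  have ht0 : t ≠ 0 := by
    rintro h; rw [h] at him; simp at him; linarith
  have hq : (t + m) ^ 2 = y * t := by
    rw [htdef]; linear_combination (1 / 4 : ℂ) * s ^ 2 * Complex.I_sq - (1 / 4 : ℂ) * hsC
  have hroot : aeval t ((weilThree m).map (Int.castRingHom ℚ)) = 0 := by
    have e : aeval t ((weilThree m).map (Int.castRingHom ℚ)) =
        (t + m) ^ 6 - 5 * t * (t + m) ^ 4 + 6 * t ^ 2 * (t + m) ^ 2 - t ^ 3 := by
      rw [aeval_def, eval₂_map, weilThree]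
      simp only [eval₂_add, eval₂_mul, eval₂_pow, eval₂_X, eval₂_C]
      simp only [eq_intCast]
      push_cast; ring
    rw [e, show (t + m) ^ 6 = ((t + m) ^ 2) ^ 3 by ring,
      show (t + m) ^ 4 = ((t + m) ^ 2) ^ 2 by ring, hq]
    linear_combination t ^ 3 * hyC
  have hti : IsIntegral ℚ t := ⟨_, weil_monic m, hroot⟩
  have hyroot : aeval (y : ℂ) cubicQ = 0 := by
    simpa [cubicQ] using hyC
  have hyi : IsIntegral ℚ (y : ℂ) := ⟨_, cubicQ_monic, hyroot⟩
  have hymin : minpoly ℚ (y : ℂ) = cubicQ :=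
    (minpoly.eq_of_irreducible_of_monic cubicQ_irreducible hyroot cubicQ_monic).symm
  have h3 : Module.finrank ℚ (IntermediateField.adjoin ℚ {(y : ℂ)}) = 3 := by
    rw [IntermediateField.adjoin.finrank hyi, hymin, cubicQ_natDegree]
  have hle : IntermediateField.adjoin ℚ {(y : ℂ)} ≤ IntermediateField.adjoin ℚ {t} := by
    rw [IntermediateField.adjoin_simple_le_iff]
    have e : (y : ℂ) = (t + m) ^ 2 / t := by rw [hq]; field_simp
    have hmem := IntermediateField.mem_adjoin_simple_self ℚ t
    rw [e]
    exact div_mem (pow_mem (add_mem hmem (intCast_mem _ m)) 2) hmem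
  have hfd : FiniteDimensional ℚ (IntermediateField.adjoin ℚ {t}) :=
    IntermediateField.adjoin.finiteDimensional hti
  have hdvd := IntermediateField.finrank_dvd_of_le_right hle
  have hmd : minpoly ℚ t ∣ (weilThree m).map (Int.castRingHom ℚ) := minpoly.dvd _ _ hroot
  have hdeg := natDegree_le_of_dvd hmd (weil_monic m).ne_zero
  rw [weil_natDegree] at hdeg
  have hne : Module.finrank ℚ (IntermediateField.adjoin ℚ {t}) ≠ 3 := by
    intro h
    have heq := IntermediateField.eq_of_le_of_finrank_eq hle (h3.trans h.symm)
    have hmem := IntermediateField.mem_adjoin_simple_self ℚ t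
    rw [← heq] at hmem
    have hreal : IntermediateField.adjoin ℚ {(y : ℂ)} ≤
        (IsScalarTower.toAlgHom ℚ ℝ ℂ).fieldRange := by
      rw [IntermediateField.adjoin_simple_le_iff]
      exact ⟨y, rfl⟩
    obtain ⟨r, hr⟩ := hreal hmem
    have : t.im = 0 := by rw [← hr]; exact Complex.ofReal_im r
    linarith
  have hpos : 0 < Module.finrank ℚ (IntermediateField.adjoin ℚ {t}) := Module.finrank_pos
  rw [h3] at hdvd
  rw [IntermediateField.adjoin.finrank hti] at hdvd hne hpos
  have h6 : (minpoly ℚ t).natDegree = 6 := by omega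
  have heq : (weilThree m).map (Int.castRingHom ℚ) = minpoly ℚ t :=
    (eq_of_monic_of_dvd_of_natDegree_le (minpoly.monic hti) (weil_monic m) hmd
      (by rw [weil_natDegree, h6]))
  rw [heq]
  exact minpoly.irreducible hti
end

section
/- For every integer x with x ≡ 1 (mod 7) or x ≡ 4 (mod 7), one has F(x) ≡ 7 (mod 49), where F(X) = X⁶ + 6X⁵ + 10X⁴ − 9X² − 2X + 1. In particular, 49 never divides F(x). -/
/-- For every integer x with x ≡ 1 (mod 7) or x ≡ 4 (mod 7), one has
F(x) ≡ 7 (mod 49), where F(X) = X⁶ + 6X⁵ + 10X⁴ − 9X² − 2X + 1; in particular 49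
does not divide F(x). -/
theorem stmt_17 (x : ℤ) (hx : x ≡ 1 [ZMOD 7] ∨ x ≡ 4 [ZMOD 7]) :
    (x ^ 6 + 6 * x ^ 5 + 10 * x ^ 4 - 9 * x ^ 2 - 2 * x + 1) ≡ 7 [ZMOD 49] ∧
    ¬ (49 : ℤ) ∣ (x ^ 6 + 6 * x ^ 5 + 10 * x ^ 4 - 9 * x ^ 2 - 2 * x + 1) := by
  have key : (49 : ℤ) ∣ (x ^ 6 + 6 * x ^ 5 + 10 * x ^ 4 - 9 * x ^ 2 - 2 * x + 1) - 7 := by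
    rcases hx with h | h
    · obtain ⟨k, hk⟩ := h.symm.dvd
      obtain rfl : x = 7 * k + 1 := by linarith
      exact ⟨(0) * k ^ 0 + (8) * k ^ 1 + (126) * k ^ 2 + (840) * k ^ 3 + (2695) * k ^ 4 + (4116) * k ^ 5 + (2401) * k ^ 6, by ring⟩
    · obtain ⟨k, hk⟩ := h.symm.dvd
      obtain rfl : x = 7 * k + 4 := by linarith
      exact ⟨(258) * k ^ 0 + (2330) * k ^ 1 + (8631) * k ^ 2 + (16800) * k ^ 3 + (18130) * k ^ 4 + (10290) * k ^ 5 + (2401) * k ^ 6, by ring⟩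
  refine ⟨(Int.modEq_iff_dvd.mpr key).symm, fun h => ?_⟩
  have h7 := dvd_sub h key
  rw [sub_sub_cancel] at h7
  norm_num at h7
end

section
/- For every integer x and every prime number ℓ, it is not the case that ℓ² divides F(x) = x⁶ + 6x⁵ + 10x⁴ − 9x² − 2x + 1 and ℓ divides G(x) = 6x⁵ + 25x⁴ + 20x³ − 18x² − 14x + 2. -/
theorem stmt_18_aux : ∀ y : ZMod 49,
    y ^ 6 + 6 * y ^ 5 + 10 * y ^ 4 - 9 * y ^ 2 - 2 * y + 1 = 0 →
    7 * (6 * y ^ 5 + 25 * y ^ 4 + 20 * y ^ 3 - 18 * y ^ 2 - 14 * y + 2) ≠ 0 := by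
  decide +kernel

/-- For every integer x and every prime ℓ, it is not the case that ℓ²
divides F(x) = x⁶ + 6x⁵ + 10x⁴ − 9x² − 2x + 1 and ℓ divides
G(x) = 6x⁵ + 25x⁴ + 20x³ − 18x² − 14x + 2. -/
theorem stmt_18 (x : ℤ) (ℓ : ℕ) (hℓ : ℓ.Prime) :
    ¬ ((ℓ : ℤ) ^ 2 ∣ (x ^ 6 + 6 * x ^ 5 + 10 * x ^ 4 - 9 * x ^ 2 - 2 * x + 1) ∧
       (ℓ : ℤ) ∣ (6 * x ^ 5 + 25 * x ^ 4 + 20 * x ^ 3 - 18 * x ^ 2 - 14 * x + 2)) := by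
  rintro ⟨hF, hG⟩
  have h7 : (ℓ : ℤ) ∣ 7 := by
    have h1 := (dvd_trans (dvd_pow_self (ℓ : ℤ) two_ne_zero) hF).mul_left
      (9 + 24 * x - 27 * x ^ 2 - 44 * x ^ 3 - 12 * x ^ 4)
    have h2 := hG.mul_left
      (-1 - 10 * x - x ^ 2 + 16 * x ^ 3 + 11 * x ^ 4 + 2 * x ^ 5)
    have h3 := dvd_add h1 h2
    ring_nf at h3
    exact h3
  have h7' : ℓ = 7 := (Nat.prime_dvd_prime_iff_eq hℓ (by norm_num)).1 (by exact_mod_cast h7)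
  subst h7'
  have e1 := (ZMod.intCast_zmod_eq_zero_iff_dvd
    (x ^ 6 + 6 * x ^ 5 + 10 * x ^ 4 - 9 * x ^ 2 - 2 * x + 1) 49).2 (by simpa using hF)
  have e2 := (ZMod.intCast_zmod_eq_zero_iff_dvd
    (7 * (6 * x ^ 5 + 25 * x ^ 4 + 20 * x ^ 3 - 18 * x ^ 2 - 14 * x + 2)) 49).2
    (by simpa using mul_dvd_mul_left (7 : ℤ) hG)
  push_cast at e1 e2
  exact stmt_18_aux (x : ZMod 49) e1 e2
end

section
/- For every integer m ≥ 1 and every prime number ℓ, it is not the case that ℓ² divides f_m(1) and ℓ divides f_m′(1), where f_m(t) = t⁶ + a t⁵ + b t⁴ + c t³ + q b t² + q² a t + q³ with a = 6m − 5, b = 15m² − 20m + 6, c = 20m³ − 30m² + 12m − 1, q = m². -/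
open Polynomial

/-- For every integer m ≥ 1 and every prime ℓ, it is not the case that
ℓ² divides f_m(1) and ℓ divides f_m′(1). -/
theorem stmt_19 (m : ℤ) (hm : 1 ≤ m) (ℓ : ℕ) (hℓ : ℓ.Prime) :
    ¬ ((ℓ : ℤ) ^ 2 ∣ (weilThree m).eval 1 ∧
       (ℓ : ℤ) ∣ (Polynomial.derivative (weilThree m)).eval 1) := by
  rintro ⟨h1, h2⟩
  -- values at 1 in terms of s = (m+1)^2
  have e1 : (weilThree m).eval 1 =
      ((m + 1) ^ 2) ^ 3 - 5 * ((m + 1) ^ 2) ^ 2 + 6 * (m + 1) ^ 2 - 1 := by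
    simp only [weilThree, eval_add, eval_mul, eval_C, eval_X, eval_pow]
    ring
  have e2 : (Polynomial.derivative (weilThree m)).eval 1 =
      3 * (((m + 1) ^ 2) ^ 3 - 5 * ((m + 1) ^ 2) ^ 2 + 6 * (m + 1) ^ 2 - 1) +
      ((m + 1) * (1 - m)) * (3 * ((m + 1) ^ 2) ^ 2 - 10 * (m + 1) ^ 2 + 6) := by
    simp only [weilThree, derivative_add, derivative_mul, derivative_C, derivative_X_pow,
      derivative_X, eval_add, eval_mul, eval_C, eval_X, eval_pow, eval_zero, eval_one,
      eval_natCast]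
    push_cast
    ring
  have hp : Prime (ℓ : ℤ) := Nat.prime_iff_prime_int.mp hℓ
  rw [e1] at h1
  rw [e2] at h2
  have hF := (dvd_pow_self (ℓ : ℤ) two_ne_zero).trans h1
  have h3 := (dvd_add_right (hF.mul_left 3)).mp h2
  have h7 : (ℓ : ℤ) ∣ 7 := by
    rcases hp.dvd_or_dvd h3 with h | h
    · rcases hp.dvd_or_dvd h with h | h
      · exfalso
        apply hp.not_dvd_one
        obtain ⟨k, hk⟩ := h
        rw [hk] at hF
        have := dvd_sub (Dvd.intro (((ℓ : ℤ) * k ^ 2) * (((ℓ * k) ^ 2) ^ 2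
          - 5 * (ℓ * k) ^ 2 + 6)) rfl) hF
        refine this.trans (dvd_of_eq ?_)
        ring
      · have h' : (ℓ : ℤ) ∣ (1 - m) * (-(m ^ 5 + 7 * m ^ 4 + 17 * m ^ 3 + 17 * m ^ 2 + 8 * m + 6)) :=
          h.mul_right _
        refine (dvd_sub hF h').trans (dvd_of_eq ?_)
        ring
    · refine (dvd_sub (h.mul_right (2 * ((m + 1) ^ 2) ^ 2 - 7 * (m + 1) ^ 2 + 3))
        (hF.mul_left (6 * (m + 1) ^ 2 - 11))).trans (dvd_of_eq ?_)
      ring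
  have hl : ℓ = 7 := by
    have : ℓ ∣ 7 := by exact_mod_cast h7
    exact (Nat.prime_dvd_prime_iff_eq hℓ (by norm_num)).mp this
  subst hl
  have key : ∀ x : ZMod 49,
      ((x + 1) ^ 2) ^ 3 - 5 * ((x + 1) ^ 2) ^ 2 + 6 * (x + 1) ^ 2 - 1 ≠ 0 := by decide
  apply key (m : ZMod 49)
  have := (ZMod.intCast_zmod_eq_zero_iff_dvd _ 49).mpr (by simpa using h1)
  exact_mod_cast this
end
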